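/- Let (X, ℬ) be a measurable space, κ a sub-Markov transition kernel on X, m a conservative reversible probability measure for κ, and ρ : X → [0, ∞) a bounded measurable function with ∫ ρ dm = 1. If the probability measure ρ·m (the measure with density ρ with respect to m) is invariant for κ, then ρ·m is conservative and reversible for κ. -/

import Mathlib

open MeasureTheory ProbabilityTheory

variable {X : Type*} [MeasurableSpace X]

/-- A function is bounded measurable. -/
def BddMeasurable {X : Type*} [MeasurableSpace X] (f : X → ℝ) : Prop :=
  Measurable f ∧ ∃ C : ℝ, ∀ x, |f x| ≤ C

/-- The transition operator `T f (x) = ∫ f(y) κ(x, dy)`. -/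
noncomputable def Tker {X : Type*} [MeasurableSpace X] (κ : Kernel X X) (f : X → ℝ) :
    X → ℝ :=
  fun x => ∫ y, f y ∂(κ x)

/-- `m` is an invariant measure: `∫ T f dm = ∫ f dm` for all bounded measurable `f`. -/
def IsInvariantMeas {X : Type*} [MeasurableSpace X] (κ : Kernel X X) (m : Measure X) : Prop :=
  ∀ f : X → ℝ, BddMeasurable f → ∫ x, Tker κ f x ∂m = ∫ x, f x ∂m

/-- `m` is a reversible measure: `∫ (T f) g dm = ∫ f (T g) dm`
for all bounded measurable `f, g`. -/
def IsReversibleMeas {X : Type*} [MeasurableSpace X] (κ : Kernel X X) (m : Measure X) : Prop :=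
  ∀ f g : X → ℝ, BddMeasurable f → BddMeasurable g →
    ∫ x, Tker κ f x * g x ∂m = ∫ x, f x * Tker κ g x ∂m

/-- `m` is a conservative measure: `∫ (T 1) g dm = ∫ g dm`
for all bounded measurable `g`, where `T 1 (x) = κ(x, X)`. -/
def IsConservativeMeas {X : Type*} [MeasurableSpace X] (κ : Kernel X X) (m : Measure X) :
    Prop :=
  ∀ g : X → ℝ, BddMeasurable g → ∫ x, (κ x Set.univ).toReal * g x ∂m = ∫ x, g x ∂m

/-- `m` is an extreme element of a set `C` of measures: `m ∈ C` and whenever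
`m = (1 - t) • m₀ + t • m₁` with `t ∈ (0,1)` and `m₀, m₁ ∈ C`, one has `m₀ = m₁`. -/
def IsExtremeElem {X : Type*} [MeasurableSpace X] (C : Set (Measure X)) (m : Measure X) :
    Prop :=
  m ∈ C ∧ ∀ t : ℝ, t ∈ Set.Ioo (0 : ℝ) 1 → ∀ m₀ m₁ : Measure X, m₀ ∈ C → m₁ ∈ C →
    m = ENNReal.ofReal (1 - t) • m₀ + ENNReal.ofReal t • m₁ → m₀ = m₁

theorem BddMeasurable.mul {f g : X → ℝ} (hf : BddMeasurable f) (hg : BddMeasurable g) :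
    BddMeasurable fun x => f x * g x := by
  obtain ⟨hfm, C, hC⟩ := hf
  obtain ⟨hgm, D, hD⟩ := hg
  refine ⟨hfm.mul hgm, C * D, fun x => ?_⟩
  rw [abs_mul]
  exact mul_le_mul (hC x) (hD x) (abs_nonneg _) ((abs_nonneg _).trans (hC x))

theorem bddMeasurable_const (c : ℝ) : BddMeasurable fun _ : X => c :=
  ⟨measurable_const, |c|, fun _ => le_rfl⟩

theorem BddMeasurable.integrable {f : X → ℝ} (hf : BddMeasurable f) (μ : Measure X)
    [IsFiniteMeasure μ] : Integrable f μ := by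
  obtain ⟨hfm, C, hC⟩ := hf
  exact Integrable.of_bound hfm.aestronglyMeasurable C (Filter.Eventually.of_forall hC)

theorem BddMeasurable.tker {κ : Kernel X X} (hκ : ∀ x, κ x Set.univ ≤ 1) {f : X → ℝ}
    (hf : BddMeasurable f) : BddMeasurable (Tker κ f) := by
  have : IsFiniteKernel κ := ⟨1, ENNReal.one_lt_top, hκ⟩
  obtain ⟨hfm, C, hC⟩ := hf
  refine ⟨(hfm.stronglyMeasurable.integral_kernel (κ := κ)).measurable, C, fun x => ?_⟩
  have hbound := norm_integral_le_of_norm_le_const (f := f) (μ := κ x)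
    (Filter.Eventually.of_forall hC)
  have hmass : (κ x).real Set.univ ≤ 1 :=
    ENNReal.toReal_le_of_le_ofReal zero_le_one (by simpa using hκ x)
  exact hbound.trans (mul_le_of_le_one_right ((abs_nonneg _).trans (hC x)) hmass)

theorem integral_withDensity_ofReal {m : Measure X} {ρ : X → ℝ} (hρm : Measurable ρ)
    (hρ0 : ∀ x, 0 ≤ ρ x) (f : X → ℝ) :
    ∫ x, f x ∂(m.withDensity fun x => ENNReal.ofReal (ρ x)) = ∫ x, f x * ρ x ∂m := by
  rw [integral_withDensity_eq_integral_toReal_smul hρm.ennreal_ofReal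
    (Filter.Eventually.of_forall fun _ => ENNReal.ofReal_lt_top)]
  simp [ENNReal.toReal_ofReal (hρ0 _), mul_comm]

theorem tker_one (κ : Kernel X X) (x : X) :
    Tker κ (fun _ => 1) x = (κ x Set.univ).toReal := by
  simp [Tker, Measure.real]

/-- If `∫ (T ρ) ρ dm = ∫ ρ² dm`, the Dirichlet form of `ρ` vanishes, so `ρ` is constant along
transitions. -/
theorem ae_ae_eq_of_integral_tker_mul_self {κ : Kernel X X} (hκ : ∀ x, κ x Set.univ ≤ 1)
    {m : Measure X} [IsFiniteMeasure m] (hcon : IsConservativeMeas κ m)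
    (hrev : IsReversibleMeas κ m) {ρ : X → ℝ} (hρ : BddMeasurable ρ)
    (h : ∫ x, Tker κ ρ x * ρ x ∂m = ∫ x, ρ x * ρ x ∂m) :
    ∀ᵐ x ∂m, ∀ᵐ y ∂(κ x), ρ y = ρ x := by
  have : IsFiniteKernel κ := ⟨1, ENNReal.one_lt_top, hκ⟩
  have hone := bddMeasurable_const (X := X) 1
  have hρρ := hρ.mul hρ
  have hsq : ∀ x y, (ρ y - ρ x) ^ 2 = ρ y * ρ y - 2 * ρ x * ρ y + ρ x * ρ x := fun x y => by ring
  have hint : ∀ x, Integrable (fun y => (ρ y - ρ x) ^ 2) (κ x) := fun x => by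
    simp_rw [hsq]
    exact ((hρρ.integrable _).sub ((hρ.integrable _).const_mul _)).add (integrable_const _)
  have hexpand : ∀ x, ∫ y, (ρ y - ρ x) ^ 2 ∂(κ x) =
      Tker κ (fun y => ρ y * ρ y) x - 2 * (Tker κ ρ x * ρ x)
        + (κ x Set.univ).toReal * (ρ x * ρ x) := fun x => by
    simp_rw [hsq]
    rw [integral_add (f := fun y => ρ y * ρ y - 2 * ρ x * ρ y)
      ((hρρ.integrable _).sub ((hρ.integrable _).const_mul _)) (integrable_const _),
      integral_sub (hρρ.integrable _) ((hρ.integrable _).const_mul _),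
      integral_const_mul, integral_const]
    simp only [Tker, Measure.real, smul_eq_mul]
    ring
  have hTsq : Integrable (Tker κ fun y => ρ y * ρ y) m := (hρρ.tker hκ).integrable m
  have hTρ : Integrable (fun x => 2 * (Tker κ ρ x * ρ x)) m :=
    (((hρ.tker hκ).mul hρ).integrable m).const_mul 2
  have hmass : Integrable (fun x => (κ x Set.univ).toReal * (ρ x * ρ x)) m := by
    simp_rw [← tker_one]
    exact ((hone.tker hκ).mul hρρ).integrable m
  have hTsq_eq : ∫ x, Tker κ (fun y => ρ y * ρ y) x ∂m = ∫ x, ρ x * ρ x ∂m := by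
    have hswap := hrev _ _ hρρ hone
    simp_rw [tker_one, mul_one, mul_comm _ (ENNReal.toReal _)] at hswap
    rw [hswap, hcon _ hρρ]
  have hzero : ∫ x, ∫ y, (ρ y - ρ x) ^ 2 ∂(κ x) ∂m = 0 := by
    simp_rw [hexpand]
    rw [integral_add (f := fun x => Tker κ (fun y => ρ y * ρ y) x - 2 * (Tker κ ρ x * ρ x))
      (hTsq.sub hTρ) hmass, integral_sub hTsq hTρ, integral_const_mul, h,
      hTsq_eq, hcon _ hρρ]
    ring
  have hintm : Integrable (fun x => ∫ y, (ρ y - ρ x) ^ 2 ∂(κ x)) m := by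
    simp_rw [hexpand]
    exact (hTsq.sub hTρ).add hmass
  rw [integral_eq_zero_iff_of_nonneg (fun x => integral_nonneg fun y => sq_nonneg _) hintm]
    at hzero
  filter_upwards [hzero] with x hx
  have hx' := (integral_eq_zero_iff_of_nonneg (fun y => sq_nonneg _) (hint x)).1 hx
  filter_upwards [hx'] with y hy
  exact sub_eq_zero.1 (pow_eq_zero_iff two_ne_zero |>.1 hy)

/-- Lemma 9, other direction: if `ρ·m` is invariant, then `ρ·m` is conservative and
reversible. -/
theorem lemma9_backward
    (κ : Kernel X X) (hκ : ∀ x, κ x Set.univ ≤ 1)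
    (m : Measure X) [IsProbabilityMeasure m]
    (hcon : IsConservativeMeas κ m) (hrev : IsReversibleMeas κ m)
    (ρ : X → ℝ) (hρ0 : ∀ x, 0 ≤ ρ x) (hρ : BddMeasurable ρ)
    (hρ1 : ∫ x, ρ x ∂m = 1)
    (h : IsInvariantMeas κ (m.withDensity fun x => ENNReal.ofReal (ρ x))) :
    IsConservativeMeas κ (m.withDensity fun x => ENNReal.ofReal (ρ x)) ∧
      IsReversibleMeas κ (m.withDensity fun x => ENNReal.ofReal (ρ x)) := by
  simp only [IsInvariantMeas, IsConservativeMeas, IsReversibleMeas,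
    integral_withDensity_ofReal hρ.1 hρ0] at h ⊢
  refine ⟨fun g hg => ?_, fun f g hf hg => ?_⟩
  · simpa only [mul_assoc] using hcon _ (hg.mul hρ)
  · have hconst := ae_ae_eq_of_integral_tker_mul_self hκ hcon hrev hρ (h ρ hρ)
    have hswap := hrev f _ hf (hg.mul hρ)
    simp only [mul_assoc]
    rw [hswap]
    refine integral_congr_ae ?_
    filter_upwards [hconst] with x hx
    congr 1
    rw [Tker, Tker, ← integral_mul_const]
    refine integral_congr_ae ?_
    filter_upwards [hx] with y hy
    rw [hy]
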